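/- Let A = (Q, Σ, δ, q₀, F) be a connected, reduced finite deterministic automaton recognizing a generalized definite language. Then there exist a finite alphabet Δ and a connected, reduced finite deterministic automaton B = (Q, Δ, δ′, q₀, F′) with the same state set Q, recognizing a definite language, such that |T(A)| ≤ |T(B)|, where T(A) = {q ↦ δ*(q,u) : u ∈ Σ⁺} and T(B) = {q ↦ δ′*(q,u) : u ∈ Δ⁺} are the transformation semigroups. Consequently, the syntactic complexity of the class of generalized definite languages equals that of the class of definite languages. -/

import Mathlib

/-- Every state of `M` is reachable from the start state. -/
def DFA.Connected {α σ : Type*} (M : DFA α σ) : Prop :=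
  ∀ q : σ, ∃ u : List α, M.evalFrom M.start u = q

/-- `M` is reduced: connected, and any two distinct states are distinguishable
by some word. -/
def DFA.Reduced {α σ : Type*} (M : DFA α σ) : Prop :=
  M.Connected ∧ ∀ p q : σ, p ≠ q →
    ∃ u : List α, ¬(M.evalFrom p u ∈ M.accept ↔ M.evalFrom q u ∈ M.accept)

/-- A language is definite if membership only depends on the suffix of
length `k`, for some constant `k`. -/
def Definite {α : Type*} (L : Language α) : Prop :=
  ∃ k : ℕ, ∀ x y : List α, y.length = k → ((x ++ y) ∈ L ↔ y ∈ L)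

/-- A language is generalized definite if membership only depends on the
prefix and suffix of length `k`, for some constant `k`. -/
def GeneralizedDefinite {α : Type*} (L : Language α) : Prop :=
  ∃ k : ℕ, ∀ x₁ x₂ y : List α, x₁.length = k → x₂.length = k →
    ((x₁ ++ y ++ x₂) ∈ L ↔ (x₁ ++ x₂) ∈ L)

/-- The transformation semigroup of `M`: the transformations of the state set
induced by nonempty words. -/
def DFA.TransSemigroup {α σ : Type*} (M : DFA α σ) : Set (σ → σ) :=
  {f | ∃ u : List α, u ≠ [] ∧ f = fun q => M.evalFrom q u}

namespace GenDef

open Set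

/-- Number of distinct restrictions to `X` of functions in `G`. -/
noncomputable def resCard {σ : Type*} (X : Set σ) (G : Set (σ → σ)) : ℕ :=
  ((fun f : σ → σ => X.restrict f) '' G).ncard

theorem resCard_union_le {σ : Type*} [Finite σ] (X Y : Set σ) (G : Set (σ → σ)) :
    resCard (X ∪ Y) G ≤ resCard X G * resCard Y G := by
  unfold resCard
  rw [← Set.ncard_prod]
  refine Set.ncard_le_ncard_of_injOn
    (fun h => (fun x : X => h ⟨x, Or.inl x.2⟩, fun y : Y => h ⟨y, Or.inr y.2⟩)) ?_ ?_
    (Set.toFinite _)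
  · rintro _ ⟨f, hf, rfl⟩
    exact ⟨⟨f, hf, rfl⟩, ⟨f, hf, rfl⟩⟩
  · intro h _ h' _ heq
    simp only [Prod.mk.injEq] at heq
    funext ⟨x, hx⟩
    rcases hx with hx | hx
    · exact congrFun heq.1 ⟨x, hx⟩
    · exact congrFun heq.2 ⟨x, hx⟩

theorem resCard_insert_le {σ : Type*} [Finite σ] (t : σ) (X : Set σ) (G : Set (σ → σ))
    (h : ∀ f ∈ G, f t ∈ X) :
    resCard (insert t X) G ≤ resCard X G * X.ncard := by
  unfold resCard
  rw [← Set.ncard_prod]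
  refine Set.ncard_le_ncard_of_injOn
    (fun h => (fun x : X => h ⟨x, Or.inr x.2⟩, h ⟨t, Or.inl rfl⟩)) ?_ ?_
    (Set.toFinite _)
  · rintro _ ⟨f, hf, rfl⟩
    exact ⟨⟨f, hf, rfl⟩, h f hf⟩
  · intro h _ h' _ heq
    simp only [Prod.mk.injEq] at heq
    funext ⟨x, hx⟩
    rcases hx with hx | hx
    · subst hx
      exact heq.2
    · exact congrFun heq.1 ⟨x, hx⟩

/-- The counting lemma for acyclic parts. -/
theorem resCard_acyclic {σ : Type*} [Finite σ] (G : Set (σ → σ)) (r : σ → σ → Prop)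
    (htrans : ∀ a b c, r a b → r b c → r a c) (W : Set σ) (hW : W.Nonempty) :
    ∀ (d : ℕ) (X : Set σ), W ⊆ X → (X \ W).ncard = d →
      (∀ s ∈ X \ W, ¬ r s s) →
      (∀ f ∈ G, ∀ s ∈ X \ W, f s ∈ X ∧ r s (f s)) →
      resCard X G * (W.ncard - 1).factorial ≤ resCard W G * (X.ncard - 1).factorial := by
  intro d
  induction d with
  | zero =>
    intro X hWX hd _ _
    rw [Set.ncard_eq_zero (Set.toFinite _), Set.diff_eq_empty] at hd
    rw [Set.Subset.antisymm hd hWX]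
  | succ d ih =>
    intro X hWX hd hirr hG
    have hne : (X \ W).Nonempty := by
      rw [← Set.ncard_pos (Set.toFinite _)]; omega
    obtain ⟨t, ht, hmin⟩ : ∃ t ∈ X \ W, ∀ s ∈ X \ W, ¬ r s t := by
      let r' : (X \ W : Set σ) → (X \ W : Set σ) → Prop := fun a b => r a b
      haveI : IsTrans _ r' := ⟨fun a b c => htrans a b c⟩
      haveI : Std.Irrefl r' := ⟨fun a => hirr a a.2⟩
      have wf : WellFounded r' := Finite.wellFounded_of_trans_of_irrefl r'
      obtain ⟨t, -, ht⟩ := wf.has_min Set.univ ⟨⟨hne.some, hne.some_mem⟩, trivial⟩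
      exact ⟨t, t.2, fun s hs => ht ⟨s, hs⟩ trivial⟩
    have hX : insert t (X \ {t}) = X := by
      rw [Set.insert_diff_singleton, Set.insert_eq_of_mem ht.1]
    have hcard : (X \ {t}).ncard = X.ncard - 1 := Set.ncard_diff_singleton_of_mem ht.1
    have hWX' : W ⊆ X \ {t} := fun w hw => ⟨hWX hw, fun h => ht.2 (by rw [← h]; exact hw)⟩
    have h1 : resCard X G ≤ resCard (X \ {t}) G * (X.ncard - 1) := by
      have := resCard_insert_le t (X \ {t}) G (fun f hf => by
        refine ⟨(hG f hf t ht).1, fun h => hirr t ht ?_⟩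
        have h2 := (hG f hf t ht).2
        rwa [show f t = t from h] at h2)
      rwa [hX, hcard] at this
    have h2 := ih (X \ {t}) hWX' (by
        rw [Set.diff_diff_comm, Set.ncard_diff_singleton_of_mem ht]; omega)
      (fun s hs => hirr s ⟨hs.1.1, hs.2⟩)
      (fun f hf s hs => by
        have h3 := hG f hf s ⟨hs.1.1, hs.2⟩
        refine ⟨⟨h3.1, fun h => hmin s ⟨hs.1.1, hs.2⟩ ?_⟩, h3.2⟩
        rw [← show f s = t from h]; exact h3.2)
    have hpos : 1 ≤ (X \ {t}).ncard := by
      rw [Nat.one_le_iff_ne_zero, ← Nat.pos_iff_ne_zero, Set.ncard_pos (Set.toFinite _)]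
      exact hW.mono hWX'
    have hfac : (X.ncard - 1).factorial = (X.ncard - 1) * ((X \ {t}).ncard - 1).factorial := by
      rw [← hcard]
      exact (Nat.mul_factorial_pred (by omega)).symm
    rw [hfac]
    calc resCard X G * (W.ncard - 1).factorial
        ≤ resCard (X \ {t}) G * (X.ncard - 1) * (W.ncard - 1).factorial :=
          Nat.mul_le_mul_right _ h1
      _ = (X.ncard - 1) * (resCard (X \ {t}) G * (W.ncard - 1).factorial) := by ring
      _ ≤ (X.ncard - 1) * (resCard W G * ((X \ {t}).ncard - 1).factorial) :=
          Nat.mul_le_mul_left _ h2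
      _ = _ := by ring

theorem fact_mul_le (a b : ℕ) :
    (a + 1).factorial * (b + 1).factorial ≤ (a + b + 1).factorial := by
  induction b with
  | zero => simp
  | succ b ih =>
    rw [Nat.factorial_succ (b + 1), show a + (b + 1) + 1 = (a + b + 1) + 1 by ring,
      Nat.factorial_succ (a + b + 1)]
    calc (a + 1).factorial * ((b + 1 + 1) * (b + 1).factorial)
        = (b + 1 + 1) * ((a + 1).factorial * (b + 1).factorial) := by ring
      _ ≤ _ := Nat.mul_le_mul (by omega) ih

section
variable {α σ : Type*} (M : DFA α σ)

/-- States reachable from `x`. -/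
def Cl (x : σ) : Set σ := {y | ∃ v, M.evalFrom x v = y}

/-- Recurrent states. -/
def Rec : Set σ := {x | ∃ u, u ≠ [] ∧ M.evalFrom x u = x}

/-- Powers of a word. -/
def wpow (u : List α) (k : ℕ) : List α := (List.replicate k u).flatten

theorem wpow_length (u : List α) (hu : u ≠ []) (k : ℕ) : k ≤ (wpow u k).length := by
  have : 1 ≤ u.length := List.length_pos_of_ne_nil hu
  simp only [wpow, List.length_flatten, List.map_replicate, List.sum_replicate, smul_eq_mul]
  exact Nat.le_mul_of_pos_right _ this

theorem eval_wpow (u : List α) (k : ℕ) (q : σ) :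
    M.evalFrom q (wpow u k) = (fun q => M.evalFrom q u)^[k] q := by
  induction k generalizing q with
  | zero => rfl
  | succ k ih =>
    rw [Function.iterate_succ_apply, ← ih]
    simp [wpow, List.replicate_succ, DFA.evalFrom_of_append]

/-- The key property: `k` letters of history and `k` letters of future. -/
def Key (k : ℕ) : Prop := ∀ x v w : List α, k ≤ x.length → k ≤ w.length →
  M.evalFrom (M.evalFrom (M.evalFrom M.start x) v) w = M.evalFrom (M.evalFrom M.start x) w

theorem exists_key (hred : M.Reduced) (hgd : GeneralizedDefinite M.accepts) :
    ∃ k, Key M k := by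
  obtain ⟨k, hk⟩ := hgd
  have hk2 : ∀ x v w : List α, k ≤ x.length → k ≤ w.length →
      ((x ++ v ++ w) ∈ M.accepts ↔ (x ++ w) ∈ M.accepts) := by
    intro x v w hx hw
    have e1 : x = x.take k ++ x.drop k := (List.take_append_drop _ _).symm
    have e2 : w = w.take (w.length - k) ++ w.drop (w.length - k) :=
      (List.take_append_drop _ _).symm
    have l1 : (x.take k).length = k := by simp [hx]
    have l2 : (w.drop (w.length - k)).length = k := by simp; omega
    have h1 := hk _ _ (x.drop k ++ v ++ w.take (w.length - k)) l1 l2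
    have h2 := hk _ _ (x.drop k ++ w.take (w.length - k)) l1 l2
    have e3 : x.take k ++ (x.drop k ++ v ++ w.take (w.length - k)) ++ w.drop (w.length - k)
        = x ++ v ++ w := by
      conv_rhs => rw [e1, e2]
      simp only [List.append_assoc]
    have e4 : x.take k ++ (x.drop k ++ w.take (w.length - k)) ++ w.drop (w.length - k)
        = x ++ w := by
      conv_rhs => rw [e1, e2]
      simp only [List.append_assoc]
    rw [e3] at h1
    rw [e4] at h2
    exact h1.trans h2.symm
  refine ⟨k, fun x v w hx hw => ?_⟩
  by_contra hne
  obtain ⟨z, hz⟩ := hred.2 _ _ hne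
  apply hz
  have := hk2 x v (w ++ z) hx (by simp; omega)
  simpa only [DFA.mem_accepts, DFA.eval, DFA.evalFrom_of_append] using this

variable {M}

theorem Key.succ {k : ℕ} (h : Key M k) : Key M (k + 1) :=
  fun x v w hx hw => h x v w (by omega) (by omega)

theorem key_rec (hc : M.Connected) {k : ℕ} (h : Key M k) {x : σ} (hx : x ∈ Rec M)
    (v w : List α) (hw : k ≤ w.length) :
    M.evalFrom (M.evalFrom x v) w = M.evalFrom x w := by
  obtain ⟨u, hu, hxu⟩ := hx
  obtain ⟨z, hz⟩ := hc x
  have e : M.evalFrom M.start (z ++ wpow u k) = x := by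
    rw [DFA.evalFrom_of_append, hz, eval_wpow]
    exact Function.iterate_fixed hxu k
  have := h (z ++ wpow u k) v w (by have := wpow_length u hu k; simp; omega) hw
  rwa [e] at this

theorem rec_return (hc : M.Connected) {k : ℕ} (h : Key M k) {x : σ} (hx : x ∈ Rec M)
    (v : List α) : ∃ w, M.evalFrom (M.evalFrom x v) w = x := by
  obtain ⟨u, hu, hxu⟩ := id hx
  refine ⟨wpow u k, ?_⟩
  rw [key_rec hc h hx v _ (wpow_length u hu k), eval_wpow]
  exact Function.iterate_fixed hxu k

theorem self_mem_Cl (x : σ) : x ∈ Cl M x := ⟨[], rfl⟩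

theorem Cl_closed {x y : σ} (hy : y ∈ Cl M x) (v : List α) : M.evalFrom y v ∈ Cl M x := by
  obtain ⟨w, rfl⟩ := hy
  exact ⟨w ++ v, DFA.evalFrom_of_append _ _ _ _⟩

theorem rec_closed (hc : M.Connected) {k : ℕ} (h : Key M k) {x : σ} (hx : x ∈ Rec M)
    (v : List α) : M.evalFrom x v ∈ Rec M := by
  obtain ⟨u, hu, hxu⟩ := id hx
  obtain ⟨w, hw⟩ := rec_return hc h hx v
  refine ⟨w ++ (u ++ v), by simp [hu], ?_⟩
  rw [DFA.evalFrom_of_append, hw, DFA.evalFrom_of_append, hxu]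

theorem Cl_back (hc : M.Connected) {k : ℕ} (h : Key M k) {x y : σ} (hx : x ∈ Rec M)
    {v : List α} (hy : y ∈ Rec M) (hyv : M.evalFrom y v ∈ Cl M x) : y ∈ Cl M x := by
  obtain ⟨w, hw⟩ := rec_return hc h hy v
  rw [← hw]
  exact Cl_closed hyv w

theorem resCard_Cl [Finite σ] (hc : M.Connected) {k : ℕ} (h : Key M k) {x : σ}
    (hx : x ∈ Rec M) : resCard (Cl M x) M.TransSemigroup ≤ (Cl M x).ncard.factorial := by
  classical
  set X := Cl M x with hX
  have hxX : x ∈ X := self_mem_Cl x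
  let Sa : σ → Set (σ → σ) := fun a => {f | f ∈ M.TransSemigroup ∧ f a = a}
  -- fixed points
  have hfix : ∀ f ∈ M.TransSemigroup, ∃ b ∈ X, f b = b ∧ ∀ y ∈ X, f y = y → y = b := by
    rintro f ⟨u, hu, rfl⟩
    have hl := wpow_length u hu k
    refine ⟨M.evalFrom x (wpow u k), ⟨_, rfl⟩, ?_, ?_⟩
    · have := key_rec hc h hx u _ hl
      conv_rhs => rw [← this]
      simp only [eval_wpow]
      rw [← Function.iterate_succ_apply' (fun q => M.evalFrom q u),
        Function.iterate_succ_apply]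
    · rintro y ⟨v, rfl⟩ hy
      rw [← key_rec hc h hx v _ hl, eval_wpow]
      exact (Function.iterate_fixed hy k).symm
  have hSa : ∀ a ∈ X, resCard X (Sa a) ≤ (X.ncard - 1).factorial := by
    intro a ha
    have := resCard_acyclic (Sa a) (fun s t => ∃ f ∈ Sa a, f s = t)
      (by
        rintro p q s ⟨f, ⟨⟨u, hu, rfl⟩, hfa⟩, rfl⟩ ⟨g, ⟨⟨v, hv, rfl⟩, hga⟩, rfl⟩
        refine ⟨fun q => M.evalFrom q (u ++ v), ⟨⟨u ++ v, by simp [hu], rfl⟩, ?_⟩, ?_⟩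
        · simp only [DFA.evalFrom_of_append] at *
          rw [hfa, hga]
        · simp only [DFA.evalFrom_of_append])
      {a} ⟨a, rfl⟩ _ X (by simpa using ha) rfl
      (by
        rintro s ⟨hs, hsa⟩ ⟨f, ⟨hf, hfa⟩, hfs⟩
        obtain ⟨b, -, -, hb⟩ := hfix f hf
        exact hsa ((hb s hs hfs).trans (hb a ha hfa).symm))
      (by
        rintro f hf s ⟨hs, hsa⟩
        refine ⟨?_, f, hf, rfl⟩
        obtain ⟨⟨u, hu, rfl⟩, -⟩ := hf
        exact Cl_closed hs u)
    have h1 : resCard {a} (Sa a) ≤ 1 := by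
      unfold resCard
      rw [Set.ncard_le_one (Set.toFinite _)]
      rintro _ ⟨f, hf, rfl⟩ _ ⟨g, hg, rfl⟩
      funext ⟨y, hy⟩
      rw [Set.mem_singleton_iff] at hy
      subst hy
      exact hf.2.trans hg.2.symm
    simp only [Set.ncard_singleton, Nat.sub_self, Nat.factorial_zero, mul_one] at this
    calc _ ≤ _ := this
      _ ≤ 1 * (X.ncard - 1).factorial := Nat.mul_le_mul_right _ h1
      _ = _ := one_mul _
  have hfin : X.Finite := Set.toFinite _
  have hsub : (fun f : σ → σ => X.restrict f) '' M.TransSemigroup ⊆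
      ⋃ a ∈ hfin.toFinset, (fun f : σ → σ => X.restrict f) '' Sa a := by
    rintro _ ⟨f, hf, rfl⟩
    obtain ⟨b, hb, hfb, -⟩ := hfix f hf
    simp only [Set.mem_iUnion]
    exact ⟨b, by simpa using hb, f, ⟨hf, hfb⟩, rfl⟩
  have hXpos : X.ncard ≠ 0 := by
    rw [← Nat.pos_iff_ne_zero, Set.ncard_pos hfin]; exact ⟨x, hxX⟩
  calc resCard X M.TransSemigroup
      ≤ (⋃ a ∈ hfin.toFinset, (fun f : σ → σ => X.restrict f) '' Sa a).ncard :=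
        Set.ncard_le_ncard hsub (Set.toFinite _)
    _ ≤ ∑ a ∈ hfin.toFinset, resCard X (Sa a) := Finset.set_ncard_biUnion_le _ _
    _ ≤ ∑ a ∈ hfin.toFinset, (X.ncard - 1).factorial :=
        Finset.sum_le_sum (fun a ha => hSa a (by simpa using ha))
    _ = X.ncard * (X.ncard - 1).factorial := by
        rw [Finset.sum_const, smul_eq_mul, Set.ncard_eq_toFinset_card X hfin]
    _ = X.ncard.factorial := Nat.mul_factorial_pred hXpos

theorem resCard_rec [Finite σ] (hc : M.Connected) {k : ℕ} (h : Key M k) :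
    ∀ (n : ℕ) (X : Set σ), X.ncard = n → X ⊆ Rec M → (∀ y ∈ X, ∀ v, M.evalFrom y v ∈ X) →
      resCard X M.TransSemigroup ≤ X.ncard.factorial := by
  intro n
  induction n using Nat.strong_induction_on with
  | _ n ih =>
    intro X hn hX hcl
    rcases X.eq_empty_or_nonempty with rfl | ⟨x, hx⟩
    · simp only [Set.ncard_empty, Nat.factorial_zero]
      unfold resCard
      rw [Set.ncard_le_one (Set.toFinite _)]
      intro a _ b _
      funext ⟨y, hy⟩
      exact hy.elim
    · have hsub : Cl M x ⊆ X := by rintro _ ⟨v, rfl⟩; exact hcl x hx v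
      have hadd : (X \ Cl M x).ncard + (Cl M x).ncard = X.ncard :=
        Set.ncard_diff_add_ncard_of_subset hsub (Set.toFinite _)
      have hpos : 0 < (Cl M x).ncard := (Set.ncard_pos (Set.toFinite _)).2 ⟨x, self_mem_Cl x⟩
      have h1 := resCard_Cl hc h (hX hx)
      have h2 := ih _ (by omega) (X \ Cl M x) rfl (fun y hy => hX hy.1)
        (fun y hy v => ⟨hcl y hy.1 v, fun hv => hy.2 (Cl_back hc h (hX hx) (hX hy.1) hv)⟩)
      have h3 := resCard_union_le (X \ Cl M x) (Cl M x) M.TransSemigroup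
      rw [Set.diff_union_of_subset hsub] at h3
      refine h3.trans ((Nat.mul_le_mul h2 h1).trans ?_)
      rw [← hadd]
      exact Nat.le_of_dvd (Nat.factorial_pos _) (Nat.factorial_mul_factorial_dvd_factorial_add _ _)

theorem card_le_of_two [Finite σ] (hc : M.Connected) {k : ℕ} (h : Key M k) {x y : σ}
    (hx : x ∈ Rec M) (hy : y ∈ Rec M) (hxy : y ∉ Cl M x) :
    Nat.card M.TransSemigroup ≤ (Nat.card σ - 1).factorial := by
  have hsub : Cl M x ⊆ Rec M := by rintro _ ⟨v, rfl⟩; exact rec_closed hc h hx v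
  have hadd : (Rec M \ Cl M x).ncard + (Cl M x).ncard = (Rec M).ncard :=
    Set.ncard_diff_add_ncard_of_subset hsub (Set.toFinite _)
  have hpos : 0 < (Cl M x).ncard := (Set.ncard_pos (Set.toFinite _)).2 ⟨x, self_mem_Cl x⟩
  have hpos2 : 0 < (Rec M \ Cl M x).ncard := (Set.ncard_pos (Set.toFinite _)).2 ⟨y, hy, hxy⟩
  have h1 := resCard_Cl hc h hx
  have h2 := resCard_rec hc h _ (Rec M \ Cl M x) rfl (fun y hy => hy.1)
    (fun y hy v => ⟨rec_closed hc h hy.1 v, fun hv => hy.2 (Cl_back hc h hx hy.1 hv)⟩)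
  have h3 := resCard_union_le (Rec M \ Cl M x) (Cl M x) M.TransSemigroup
  rw [Set.diff_union_of_subset hsub] at h3
  have h4 : resCard (Rec M) M.TransSemigroup ≤ ((Rec M).ncard - 1).factorial := by
    refine h3.trans ((Nat.mul_le_mul h2 h1).trans ?_)
    rw [← hadd]
    obtain ⟨a, ha⟩ := Nat.exists_eq_succ_of_ne_zero hpos.ne'
    obtain ⟨b, hb⟩ := Nat.exists_eq_succ_of_ne_zero hpos2.ne'
    rw [ha, hb]
    have := fact_mul_le b a
    rwa [show b.succ + a.succ - 1 = b + a + 1 by omega]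
  have h5 := resCard_acyclic M.TransSemigroup (fun s t => ∃ u, u ≠ [] ∧ M.evalFrom s u = t)
    (by
      rintro p q s ⟨u, hu, rfl⟩ ⟨v, hv, rfl⟩
      exact ⟨u ++ v, by simp [hu], DFA.evalFrom_of_append _ _ _ _⟩)
    (Rec M) ⟨x, hx⟩ _ Set.univ (Set.subset_univ _) rfl (fun s hs hr => hs.2 hr)
    (by
      rintro f ⟨u, hu, rfl⟩ s _
      exact ⟨trivial, u, hu, rfl⟩)
  have h6 : resCard Set.univ M.TransSemigroup ≤ (Nat.card σ - 1).factorial := by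
    rw [Set.ncard_univ] at h5
    have h7 := h5.trans (Nat.mul_le_mul_right _ h4)
    rw [mul_comm] at h7
    exact Nat.le_of_mul_le_mul_left h7 (Nat.factorial_pos _)
  have h8 : resCard Set.univ M.TransSemigroup = Nat.card M.TransSemigroup := by
    unfold resCard
    rw [Set.ncard_image_of_injective]
    · exact (Nat.card_coe_set_eq _).symm
    · intro f g hfg
      funext q
      exact congrFun hfg ⟨q, trivial⟩
  rwa [h8] at h6

theorem definite_of_one (hc : M.Connected) {k : ℕ} (h : Key M k)
    (hone : ∀ x ∈ Rec M, ∀ y ∈ Rec M, y ∈ Cl M x) : Definite M.accepts := by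
  have h' := h.succ
  refine ⟨(k + 1) + (k + 1), fun x y hy => ?_⟩
  obtain ⟨y1, y2, rfl, l1, l2⟩ : ∃ y1 y2 : List α, y = y1 ++ y2 ∧ y1.length = k + 1 ∧
      y2.length = k + 1 :=
    ⟨y.take (k + 1), y.drop (k + 1), (List.take_append_drop _ _).symm, by simp; omega,
      by simp; omega⟩
  have hne : y2 ≠ [] := by rintro rfl; simp at l2
  have key1 := fun v => h' y1 v y2 (by omega) (by omega)
  have key2 := fun v => h' (x ++ y1) v y2 (by simp; omega) (by omega)
  obtain ⟨v, hv⟩ := hone _ ⟨y2, hne, key1 y2⟩ _ ⟨y2, hne, key2 y2⟩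
  have e : M.evalFrom (M.evalFrom M.start y1) y2 =
      M.evalFrom (M.evalFrom M.start (x ++ y1)) y2 := by
    rw [← key2 y2, ← hv, ← DFA.evalFrom_of_append _ _ y2 v, key1]
  simp only [DFA.mem_accepts, DFA.eval]
  rw [← List.append_assoc, DFA.evalFrom_of_append, DFA.evalFrom_of_append M _ y1 y2, e]

end

/-- Alphabet of the universal definite automaton. -/
abbrev Letter (m : ℕ) : Type := ((i : Fin m) → Fin (i.1 + 1)) ⊕ Fin (m + 1)

/-- The decreasing map coded by `g`. -/
def dec {m : ℕ} (g : (i : Fin m) → Fin (i.1 + 1)) : Fin (m + 1) → Fin (m + 1) :=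
  Fin.cases 0 (fun i => ⟨(g i).1, by have := (g i).2; have := i.2; omega⟩)

theorem dec_le {m : ℕ} (g : (i : Fin m) → Fin (i.1 + 1)) (p : Fin (m + 1)) :
    (dec g p).1 ≤ p.1 - 1 := by
  induction p using Fin.cases with
  | zero => simp [dec]
  | succ i => have := (g i).2; simp [dec]; omega

/-- Action of letters. -/
def act {m : ℕ} : Letter m → Fin (m + 1) → Fin (m + 1)
  | Sum.inl g => dec g
  | Sum.inr c => fun _ => c

/-- The universal definite automaton. -/
def U {σ : Type*} {m : ℕ} (e : σ ≃ Fin (m + 1)) (s : σ) : DFA (Letter m) σ where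
  step q a := e.symm (act a (e q))
  start := s
  accept := {q | e q = 0}

theorem U_sync {σ : Type*} {m : ℕ} (e : σ ≃ Fin (m + 1)) (s : σ) (y : List (Letter m)) :
    ∀ p q : σ, (e p).1 ≤ y.length → (e q).1 ≤ y.length →
      (U e s).evalFrom p y = (U e s).evalFrom q y := by
  induction y with
  | nil =>
    intro p q hp hq
    have : p = q := e.injective (Fin.ext (by simp at hp hq; simp [hp, hq]))
    rw [this]
  | cons a y ih =>
    intro p q hp hq
    simp only [List.length_cons] at hp hq
    rw [DFA.evalFrom_cons, DFA.evalFrom_cons]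
    rcases a with g | c
    · apply ih
      · have := dec_le g (e p)
        simp [U, act]; omega
      · have := dec_le g (e q)
        simp [U, act]; omega
    · rfl

theorem U_reduced {σ : Type*} {m : ℕ} (e : σ ≃ Fin (m + 1)) (s : σ) : (U e s).Reduced := by
  have main : ∀ p q : σ, (e p).1 < (e q).1 → ∃ u : List (Letter m),
      ¬((U e s).evalFrom p u ∈ (U e s).accept ↔ (U e s).evalFrom q u ∈ (U e s).accept) := by
    intro p q hpq
    by_cases hp : e p = 0
    · refine ⟨[], fun h => ?_⟩
      have h2 : e q = 0 := h.1 hp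
      rw [h2] at hpq
      simp at hpq
    · classical
      -- send `p` to `0` and every other nonzero state to something nonzero if possible
      refine ⟨[Sum.inl (fun i => if i.1 + 1 = (e q).1 then
        ⟨min (e p).1 i.1, by omega⟩ else 0)], fun h => ?_⟩
      obtain ⟨i, hi⟩ := Fin.exists_succ_eq.2 hp
      obtain ⟨j, hj⟩ := Fin.exists_succ_eq.2 (show e q ≠ 0 by rintro h0; simp [h0] at hpq)
      rw [← hi, ← hj] at hpq
      simp only [Fin.val_succ] at hpq
      have h1 := h.1
      simp only [U, DFA.evalFrom_cons, DFA.evalFrom_nil, act, Set.mem_setOf_eq,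
        Equiv.apply_symm_apply, ← hi, ← hj, dec, Fin.cases_succ] at h1
      simp only [Fin.ext_iff, Fin.val_succ] at h1
      have hne : ¬ (i.1 + 1 = j.1 + 1) := by omega
      rw [if_neg hne, if_pos trivial] at h1
      have := h1 rfl
      simp only [Fin.val_zero] at this
      omega
  refine ⟨fun q => ?_, fun p q hpq => ?_⟩
  · exact ⟨[Sum.inr (e q)], by simp [U, act]⟩
  · rcases lt_trichotomy (e p).1 (e q).1 with h | h | h
    · exact main p q h
    · exact (hpq (e.injective (Fin.ext h))).elim
    · obtain ⟨u, hu⟩ := main q p h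
      exact ⟨u, fun h => hu h.symm⟩

theorem U_definite {σ : Type*} {m : ℕ} (e : σ ≃ Fin (m + 1)) (s : σ) :
    Definite (U e s).accepts := by
  refine ⟨m, fun x y hy => ?_⟩
  simp only [DFA.mem_accepts, DFA.eval, DFA.evalFrom_of_append]
  rw [U_sync e s y _ (U e s).start (by rw [hy]; exact Nat.le_of_lt_succ (Fin.is_lt _))
    (by rw [hy]; exact Nat.le_of_lt_succ (Fin.is_lt _))]

theorem U_card {σ : Type*} [Finite σ] {m : ℕ} (e : σ ≃ Fin (m + 1)) (s : σ) :
    m.factorial ≤ Nat.card (U e s).TransSemigroup := by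
  have h1 : Nat.card ((i : Fin m) → Fin (i.1 + 1)) = m.factorial := by
    rw [Nat.card_pi]
    simp only [Nat.card_eq_fintype_card, Fintype.card_fin]
    rw [Fin.prod_univ_eq_prod_range (fun i => i + 1), Finset.prod_range_add_one_eq_factorial]
  rw [← h1]
  refine Nat.card_le_card_of_injective
    (fun g => (⟨fun q => (U e s).evalFrom q [Sum.inl g], [Sum.inl g], by simp, rfl⟩ :
      (U e s).TransSemigroup)) ?_
  intro g g' hg
  have h2 := congrArg Subtype.val hg
  funext i
  have h3 := congrFun h2 (e.symm i.succ)
  simp [U, act, dec] at h3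
  exact Fin.ext h3

end GenDef

/-- For every connected, reduced finite automaton `M` recognizing a generalized
definite language there is a finite alphabet `β` and a connected, reduced
automaton `B` over `β` on the same state set and with the same start state,
recognizing a definite language, whose transformation semigroup is at least as
large as that of `M`.  (Consequently the syntactic complexities of the classes
of definite and generalized definite languages coincide.) -/
theorem generalizedDefinite_transSemigroup_le_definite {α σ : Type*}
    [Finite α] [Finite σ] (M : DFA α σ) (hred : M.Reduced)
    (hgd : GeneralizedDefinite M.accepts) :
    ∃ (β : Type) (_ : Finite β) (B : DFA β σ),
      B.start = M.start ∧ B.Reduced ∧ Definite B.accepts ∧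
      Nat.card M.TransSemigroup ≤ Nat.card B.TransSemigroup := by
  obtain ⟨k, hk⟩ := GenDef.exists_key M hred hgd
  by_cases hone : ∀ x ∈ GenDef.Rec M, ∀ y ∈ GenDef.Rec M, y ∈ GenDef.Cl M x
  · obtain ⟨k', hdef⟩ := GenDef.definite_of_one hred.1 hk hone
    let e : α ≃ Fin (Nat.card α) := Finite.equivFin α
    let B : DFA (Fin (Nat.card α)) σ := ⟨fun q a => M.step q (e.symm a), M.start, M.accept⟩
    have hB : ∀ (u : List (Fin (Nat.card α))) (q : σ),
        B.evalFrom q u = M.evalFrom q (u.map e.symm) := by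
      intro u
      induction u with
      | nil => intro q; rfl
      | cons a u ih =>
        intro q
        rw [DFA.evalFrom_cons, ih, List.map_cons, DFA.evalFrom_cons]
    have hM : ∀ (u : List α) (q : σ), B.evalFrom q (u.map e) = M.evalFrom q u := by
      intro u q
      rw [hB, List.map_map]
      simp
    refine ⟨Fin (Nat.card α), inferInstance, B, rfl, ⟨fun q => ?_, fun p q hpq => ?_⟩,
      ⟨k', fun x y hy => ?_⟩, ?_⟩
    · obtain ⟨u, hu⟩ := hred.1 q
      exact ⟨u.map e, (hM u _).trans hu⟩
    · obtain ⟨u, hu⟩ := hred.2 p q hpq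
      refine ⟨u.map e, ?_⟩
      rw [hM, hM]
      exact hu
    · have := hdef (x.map e.symm) (y.map e.symm) (by simpa using hy)
      simp only [DFA.mem_accepts, DFA.eval, ← List.map_append] at this
      simp only [DFA.mem_accepts, DFA.eval, hB]
      exact this
    · refine Nat.card_mono (Set.toFinite _) ?_
      rintro f ⟨u, hu, rfl⟩
      exact ⟨u.map e, by simpa using hu, funext fun q => (hM u q).symm⟩
  · push Not at hone
    obtain ⟨x, hx, y, hy, hxy⟩ := hone
    have hcard := GenDef.card_le_of_two hred.1 hk hx hy hxy
    haveI : Nonempty σ := ⟨M.start⟩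
    obtain ⟨m, hm⟩ := Nat.exists_eq_succ_of_ne_zero (Nat.card_pos (α := σ)).ne'
    let e : σ ≃ Fin (m + 1) := Finite.equivFinOfCardEq hm
    refine ⟨GenDef.Letter m, inferInstance, GenDef.U e M.start, rfl, GenDef.U_reduced e _,
      GenDef.U_definite e _, ?_⟩
    rw [hm] at hcard
    exact hcard.trans (GenDef.U_card e _)
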